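/- Let $K$ be any field and $n\geq 4$. Then for all $h,f,g\in U=K[y_1,\ldots,y_n]$, the endomorphism $B(h,f,g)=(x_1+[x_1,x_n]hfg+[x_2,x_n]hg^2,\ x_2-[x_1,x_n]hf^2-[x_2,x_n]hfg,\ x_3,\ldots,x_n)$ of $M_n$ is an automorphism and is almost tame. -/

import Mathlib

noncomputable section

/-- The free metabelian Lie algebra of rank `n` over `K`: the quotient of the free Lie
algebra on `n` generators by its second derived ideal. -/
abbrev FreeMetabelianLie (K : Type) [Field K] (n : ℕ) : Type :=
  FreeLieAlgebra K (Fin n) ⧸ LieAlgebra.derivedSeries K (FreeLieAlgebra K (Fin n)) 2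

/-- The free generators `x₁, …, xₙ` of the free metabelian Lie algebra. -/
def xg (K : Type) [Field K] (n : ℕ) (i : Fin n) : FreeMetabelianLie K n :=
  LieSubmodule.Quotient.mk (N := LieAlgebra.derivedSeries K (FreeLieAlgebra K (Fin n)) 2)
    (FreeLieAlgebra.of K i)

/-- The group structure on Lie algebra automorphisms, with `(e * f) x = e (f x)`. -/
instance lieAutGroup (K : Type) [CommRing K] (L : Type) [LieRing L] [LieAlgebra K L] :
    Group (L ≃ₗ⁅K⁆ L) where
  mul e f := f.trans e
  one := LieEquiv.refl
  inv := LieEquiv.symm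
  mul_assoc _ _ _ := LieEquiv.ext fun _ => rfl
  one_mul _ := LieEquiv.ext fun _ => rfl
  mul_one _ := LieEquiv.ext fun _ => rfl
  inv_mul_cancel e := LieEquiv.ext fun x => e.symm_apply_apply x

/-- An automorphism of the free metabelian Lie algebra is elementary if it maps some `xᵢ` to
`α • xᵢ + f`, with `0 ≠ α ∈ K` and `f` in the subalgebra generated by the other generators,
and fixes all other generators. -/
def IsElementaryAut (K : Type) [Field K] (n : ℕ)
    (φ : FreeMetabelianLie K n ≃ₗ⁅K⁆ FreeMetabelianLie K n) : Prop :=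
  ∃ (i : Fin n) (α : K) (f : FreeMetabelianLie K n), α ≠ 0 ∧
    f ∈ LieSubalgebra.lieSpan K (FreeMetabelianLie K n) (xg K n '' {j | j ≠ i}) ∧
    φ (xg K n i) = α • xg K n i + f ∧ ∀ j : Fin n, j ≠ i → φ (xg K n j) = xg K n j

/-- A tame automorphism is one in the subgroup generated by the elementary automorphisms. -/
def IsTame (K : Type) [Field K] (n : ℕ)
    (φ : FreeMetabelianLie K n ≃ₗ⁅K⁆ FreeMetabelianLie K n) : Prop :=
  φ ∈ Subgroup.closure {ψ | IsElementaryAut K n ψ}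

/-- A Chein automorphism (one-row transformation) moves only one generator. -/
def IsCheinAut (K : Type) [Field K] (n : ℕ)
    (φ : FreeMetabelianLie K n ≃ₗ⁅K⁆ FreeMetabelianLie K n) : Prop :=
  ∃ i : Fin n, ∀ j : Fin n, j ≠ i → φ (xg K n j) = xg K n j

/-- An almost tame automorphism is one in the subgroup generated by Chein automorphisms. -/
def IsAlmostTame (K : Type) [Field K] (n : ℕ)
    (φ : FreeMetabelianLie K n ≃ₗ⁅K⁆ FreeMetabelianLie K n) : Prop :=
  φ ∈ Subgroup.closure {ψ | IsCheinAut K n ψ}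

/-- `monoSet K n k` is the set of right-normed Lie monomials of degree `k+1` in the
generators. -/
def monoSet (K : Type) [Field K] (n : ℕ) : ℕ → Set (FreeMetabelianLie K n)
  | 0 => Set.range (xg K n)
  | k + 1 => {z | ∃ u ∈ monoSet K n k, ∃ i : Fin n, z = ⁅u, xg K n i⁆}

/-- `gradePiece K n k` (for `k ≥ 1`) is the homogeneous component `L_k` of the standard
grading: the linear span of the Lie monomials of degree `k` in the generators. -/
def gradePiece (K : Type) [Field K] (n : ℕ) (k : ℕ) : Submodule K (FreeMetabelianLie K n) :=
  Submodule.span K (monoSet K n (k - 1))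

/-- The automorphism `φ = (l₁ + m₁, …, lₙ + mₙ)` (with `lᵢ` linear, `mᵢ ∈ [M,M]`) has lower
degree `≥ d`: each `φ(xᵢ)` lies in `L₁ ⊕ (⨆ k ≥ d, L_k)`. -/
def AutLdegGE (K : Type) [Field K] (n : ℕ)
    (φ : FreeMetabelianLie K n ≃ₗ⁅K⁆ FreeMetabelianLie K n) (d : ℕ) : Prop :=
  ∀ i : Fin n, φ (xg K n i) ∈
    gradePiece K n 1 ⊔ ⨆ (k : ℕ) (_ : d ≤ k), gradePiece K n k

/-- The action of a polynomial `a ∈ U = K[y₁,…,yₙ]` on `m`; for `m ∈ [M,M]` this is the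
canonical `U`-module action on the derived ideal, determined by `m ⬝ yᵢ = ⁅m, xᵢ⁆`. -/
def polyAct (K : Type) [Field K] (n : ℕ) (a : MvPolynomial (Fin n) K)
    (m : FreeMetabelianLie K n) : FreeMetabelianLie K n :=
  ∑ d ∈ a.support, a.coeff d •
    ((List.ofFn fun i : Fin n =>
      (-(LieAlgebra.ad K (FreeMetabelianLie K n) (xg K n i))) ^ (d i)).prod m)

/-- The polynomial `a` has lower degree `≥ d`: every monomial of `a` has total degree `≥ d`. -/
def PolyLdegGE (K : Type) [Field K] (n : ℕ) (a : MvPolynomial (Fin n) K) (d : ℕ) : Prop :=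
  ∀ v ∈ a.support, d ≤ ∑ i, v i

/-- An exponential automorphism: `exp (ad z) = id + ad z` for some `z ∈ [M,M]`. -/
def IsExponentialAut (K : Type) [Field K] (n : ℕ)
    (φ : FreeMetabelianLie K n ≃ₗ⁅K⁆ FreeMetabelianLie K n) : Prop :=
  ∃ z ∈ LieAlgebra.derivedSeries K (FreeMetabelianLie K n) 1,
    ∀ m : FreeMetabelianLie K n, φ m = m + ⁅z, m⁆

end

theorem lie_mem_derivedSeries_succ {K L : Type} [Field K] [LieRing L] [LieAlgebra K L] {k : ℕ}
    {a b : L} (ha : a ∈ LieAlgebra.derivedSeries K L k) (hb : b ∈ LieAlgebra.derivedSeries K L k) :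
    ⁅a, b⁆ ∈ LieAlgebra.derivedSeries K L (k + 1) := by
  rw [LieAlgebra.derivedSeries_def, LieAlgebra.derivedSeriesOfIdeal_succ]
  exact LieSubmodule.lie_mem_lie ha hb

noncomputable section

open MvPolynomial

namespace FreeMetabelianLie

variable {K : Type} [Field K] {n : ℕ}

theorem derivedSeries_two_eq_bot (K : Type) [Field K] (n : ℕ) :
    LieAlgebra.derivedSeries K (FreeMetabelianLie K n) 2 = ⊥ := by
  let π : FreeLieAlgebra K (Fin n) →ₗ⁅K⁆ FreeMetabelianLie K n :=
    { LieSubmodule.Quotient.mk' (LieAlgebra.derivedSeries K (FreeLieAlgebra K (Fin n)) 2) with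
      map_lie' := rfl }
  have hπ : Function.Surjective π := LieSubmodule.Quotient.surjective_mk' _
  rw [← LieIdeal.derivedSeries_map_eq (f := π) 2 hπ, LieIdeal.map_eq_bot_iff]
  intro z hz
  rw [LieHom.mem_ker]
  exact (LieSubmodule.Quotient.mk_eq_zero _).2 hz

theorem lie_eq_zero_of_mem_derived {a b : FreeMetabelianLie K n}
    (ha : a ∈ LieAlgebra.derivedSeries K (FreeMetabelianLie K n) 1)
    (hb : b ∈ LieAlgebra.derivedSeries K (FreeMetabelianLie K n) 1) : ⁅a, b⁆ = 0 := by
  have h : ⁅a, b⁆ ∈ LieAlgebra.derivedSeries K (FreeMetabelianLie K n) 2 :=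
    lie_mem_derivedSeries_succ ha hb
  rwa [derivedSeries_two_eq_bot, LieSubmodule.mem_bot] at h

theorem lie_mem_derived (a b : FreeMetabelianLie K n) :
    ⁅a, b⁆ ∈ LieAlgebra.derivedSeries K (FreeMetabelianLie K n) 1 :=
  lie_mem_derivedSeries_succ (LieSubmodule.mem_top a) (LieSubmodule.mem_top b)

/-- The endomorphism of the free metabelian Lie algebra with prescribed values on the
generators. -/
def lift (v : Fin n → FreeMetabelianLie K n) :
    FreeMetabelianLie K n →ₗ⁅K⁆ FreeMetabelianLie K n :=
  let F := FreeLieAlgebra.lift K v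
  have hF : (LieAlgebra.derivedSeries K (FreeLieAlgebra K (Fin n)) 2).toSubmodule ≤
      LinearMap.ker (F : FreeLieAlgebra K (Fin n) →ₗ[K] FreeMetabelianLie K n) := by
    intro z hz
    have h := LieIdeal.derivedSeries_map_le (f := F) 2 (LieIdeal.mem_map hz)
    rw [derivedSeries_two_eq_bot, LieSubmodule.mem_bot] at h
    exact h
  { Submodule.liftQ _ (F : FreeLieAlgebra K (Fin n) →ₗ[K] FreeMetabelianLie K n) hF with
    map_lie' := by
      intro a b
      obtain ⟨a, rfl⟩ := LieSubmodule.Quotient.surjective_mk' _ a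
      obtain ⟨b, rfl⟩ := LieSubmodule.Quotient.surjective_mk' _ b
      exact F.map_lie a b }

@[simp]
theorem lift_xg (v : Fin n → FreeMetabelianLie K n) (i : Fin n) : lift v (xg K n i) = v i :=
  FreeLieAlgebra.lift_of_apply v i

theorem hom_ext {F G : FreeMetabelianLie K n →ₗ⁅K⁆ FreeMetabelianLie K n}
    (h : ∀ i, F (xg K n i) = G (xg K n i)) : F = G := by
  let π : FreeLieAlgebra K (Fin n) →ₗ⁅K⁆ FreeMetabelianLie K n :=
    { LieSubmodule.Quotient.mk' (LieAlgebra.derivedSeries K (FreeLieAlgebra K (Fin n)) 2) with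
      map_lie' := rfl }
  have hπ : F.comp π = G.comp π := FreeLieAlgebra.hom_ext h
  ext a
  obtain ⟨a, rfl⟩ := LieSubmodule.Quotient.surjective_mk' _ a
  exact LieHom.congr_fun hπ a

/-- The derived ideal of the free metabelian Lie algebra. -/
abbrev Derived (K : Type) [Field K] (n : ℕ) : Type :=
  LieAlgebra.derivedSeries K (FreeMetabelianLie K n) 1

/-- The action `d ↦ ⁅d, xᵢ⁆` of a generator on the derived ideal. -/
def bracketGen (K : Type) [Field K] (n : ℕ) (i : Fin n) : Module.End K (Derived K n) :=
  -(LieModule.toEnd K (FreeMetabelianLie K n) (Derived K n) (xg K n i))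

theorem coe_bracketGen (i : Fin n) (d : Derived K n) :
    (bracketGen K n i d : FreeMetabelianLie K n) = ⁅(d : FreeMetabelianLie K n), xg K n i⁆ := by
  rw [← lie_skew]
  rfl

theorem bracketGen_comm (i j : Fin n) :
    bracketGen K n i * bracketGen K n j = bracketGen K n j * bracketGen K n i := by
  refine LinearMap.ext fun d => Subtype.ext ?_
  simp only [Module.End.mul_apply, coe_bracketGen]
  rw [lie_lie, lie_eq_zero_of_mem_derived d.2 (lie_mem_derived _ _), zero_sub, lie_skew]

instance isMulCommutative_adjoin_bracketGen :
    IsMulCommutative (Algebra.adjoin K (Set.range (bracketGen K n))) :=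
  Algebra.isMulCommutative_adjoin K (by
    rintro _ ⟨i, rfl⟩ _ ⟨j, rfl⟩
    exact bracketGen_comm i j)

open scoped IsMulCommutative in
/-- The action of the polynomial ring on the derived ideal, with `yᵢ` acting as
`d ↦ ⁅d, xᵢ⁆`. -/
def action (K : Type) [Field K] (n : ℕ) :
    MvPolynomial (Fin n) K →ₐ[K] Module.End K (Derived K n) :=
  (Algebra.adjoin K (Set.range (bracketGen K n))).val.comp
    (aeval fun i => ⟨bracketGen K n i, Algebra.subset_adjoin ⟨i, rfl⟩⟩)

theorem action_X (i : Fin n) : action K n (X i) = bracketGen K n i := by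
  simp [action]

open scoped IsMulCommutative in
theorem action_eq_sum (a : MvPolynomial (Fin n) K) :
    action K n a =
      ∑ d ∈ a.support, a.coeff d • (List.ofFn fun i => bracketGen K n i ^ d i).prod := by
  simp only [action, AlgHom.comp_apply, aeval_def, eval₂_eq', ← List.prod_ofFn, map_sum,
    map_list_prod, List.map_ofFn, ← Algebra.smul_def, map_smul]
  rfl

instance : Module (MvPolynomial (Fin n) K) (Derived K n) :=
  Module.compHom _ (action K n).toRingHom

theorem smul_def (a : MvPolynomial (Fin n) K) (d : Derived K n) : a • d = action K n a d :=
  rfl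

theorem coe_X_smul (i : Fin n) (d : Derived K n) :
    ((X i : MvPolynomial (Fin n) K) • d : Derived K n) =
      ⁅(d : FreeMetabelianLie K n), xg K n i⁆ := by
  rw [smul_def, action_X, coe_bracketGen]

theorem C_smul (c : K) (d : Derived K n) : (C c : MvPolynomial (Fin n) K) • d = c • d := by
  rw [smul_def, ← algebraMap_eq, AlgHom.commutes]
  rfl

theorem polyAct_coe (a : MvPolynomial (Fin n) K) (d : Derived K n) :
    polyAct K n a d = (a • d : Derived K n) := by
  have key : ∀ (l : List (Fin n)) (e : Fin n → ℕ) (d : Derived K n),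
      (l.map fun i => (-(LieAlgebra.ad K (FreeMetabelianLie K n) (xg K n i))) ^ e i).prod d =
        ((l.map fun i => bracketGen K n i ^ e i).prod d : Derived K n) := by
    intro l e d
    induction l with
    | nil => rfl
    | cons i l ih =>
      simp only [List.map_cons, List.prod_cons, Module.End.mul_apply, ih]
      generalize (l.map fun i => bracketGen K n i ^ e i).prod d = d'
      induction e i with
      | zero => rfl
      | succ k ihk =>
        rw [pow_succ', pow_succ', Module.End.mul_apply, Module.End.mul_apply, ihk, coe_bracketGen,
          ← lie_skew]
        rfl
  simp only [polyAct, smul_def, action_eq_sum, List.ofFn_eq_map, key, LinearMap.sum_apply,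
    LinearMap.smul_apply]
  simp

theorem map_mem_derived (F : FreeMetabelianLie K n →ₗ⁅K⁆ FreeMetabelianLie K n)
    {d : FreeMetabelianLie K n} (hd : d ∈ LieAlgebra.derivedSeries K (FreeMetabelianLie K n) 1) :
    F d ∈ LieAlgebra.derivedSeries K (FreeMetabelianLie K n) 1 :=
  LieIdeal.derivedSeries_map_le (f := F) 1 (LieIdeal.mem_map hd)

/-- The restriction of an endomorphism to the derived ideal. -/
def mapDerived (F : FreeMetabelianLie K n →ₗ⁅K⁆ FreeMetabelianLie K n) (d : Derived K n) :
    Derived K n :=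
  ⟨F d, map_mem_derived F d.2⟩

/-- The endomorphism `F` maps `xᵢ` to `xᵢ + mᵢ`. -/
def IsShift (F : FreeMetabelianLie K n →ₗ⁅K⁆ FreeMetabelianLie K n) (m : Fin n → Derived K n) :
    Prop :=
  ∀ i, F (xg K n i) = xg K n i + m i

/-- The bracket of two generators as an element of the derived ideal. -/
def genBracket (K : Type) [Field K] {n : ℕ} (i j : Fin n) : Derived K n :=
  ⟨⁅xg K n i, xg K n j⁆, lie_mem_derived _ _⟩

namespace IsShift

variable {F : FreeMetabelianLie K n →ₗ⁅K⁆ FreeMetabelianLie K n} {m : Fin n → Derived K n}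

theorem mapDerived_add (d e : Derived K n) :
    mapDerived F (d + e) = mapDerived F d + mapDerived F e :=
  Subtype.ext (F.map_add d e)

theorem mapDerived_smul (hF : IsShift F m) (a : MvPolynomial (Fin n) K) (d : Derived K n) :
    mapDerived F (a • d) = a • mapDerived F d := by
  induction a using MvPolynomial.induction_on generalizing d with
  | C c =>
    rw [C_smul, C_smul]
    exact Subtype.ext (F.map_smul c d)
  | add p q hp hq => rw [add_smul, add_smul, mapDerived_add, hp, hq]
  | mul_X p i hp =>
    rw [mul_smul, mul_smul, hp]
    congr 1
    refine Subtype.ext ?_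
    simp only [mapDerived, coe_X_smul, LieHom.map_lie, hF i, lie_add]
    rw [lie_eq_zero_of_mem_derived (map_mem_derived F d.2) (m i).2, add_zero]

theorem mapDerived_genBracket (hF : IsShift F m) (i j : Fin n) :
    mapDerived F (genBracket K i j) =
      genBracket K i j + (X j : MvPolynomial (Fin n) K) • m i
        - (X i : MvPolynomial (Fin n) K) • m j := by
  refine Subtype.ext ?_
  change F ⁅xg K n i, xg K n j⁆ = ⁅xg K n i, xg K n j⁆ + ((X j : MvPolynomial (Fin n) K) • m i
    : Derived K n) - ((X i : MvPolynomial (Fin n) K) • m j : Derived K n)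
  rw [LieHom.map_lie, hF i, hF j, coe_X_smul, coe_X_smul, add_lie, lie_add, lie_add,
    lie_eq_zero_of_mem_derived (m i).2 (m j).2, ← lie_skew (m j : FreeMetabelianLie K n)]
  abel

end IsShift

/-- The combination `∑ₗ αₗ • [xₗ, x_N]`. -/
def row (N : Fin n) (α : Fin n → MvPolynomial (Fin n) K) : Derived K n :=
  ∑ l, α l • genBracket K l N

theorem row_add (N : Fin n) (α β : Fin n → MvPolynomial (Fin n) K) :
    row N (α + β) = row N α + row N β := by
  simp [row, add_smul, Finset.sum_add_distrib]

theorem row_neg (N : Fin n) (α : Fin n → MvPolynomial (Fin n) K) :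
    row N (-α) = -row N α := by
  simp [row]

theorem row_smul (N : Fin n) (s : MvPolynomial (Fin n) K) (α : Fin n → MvPolynomial (Fin n) K) :
    row N (s • α) = s • row N α := by
  simp [row, mul_smul, Finset.smul_sum]

theorem row_single (N i : Fin n) (p : MvPolynomial (Fin n) K) :
    row N (Pi.single i p) = p • genBracket K i N := by
  rw [row, Finset.sum_eq_single i] <;> simp +contextual

/-- A shift along a column `v` with `v N = 0` fixes the rows orthogonal to `v`. -/
theorem IsShift.map_row {F : FreeMetabelianLie K n →ₗ⁅K⁆ FreeMetabelianLie K n} {N : Fin n}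
    {v β : Fin n → MvPolynomial (Fin n) K} {c : Derived K n} (hF : IsShift F fun l => v l • c)
    (hv : v N = 0) (hβ : β ⬝ᵥ v = 0) : mapDerived F (row N β) = row N β := by
  let G : Derived K n →+ Derived K n := AddMonoidHom.mk' (mapDerived F) mapDerived_add
  have h : ∀ l, mapDerived F (β l • genBracket K l N) =
      β l • genBracket K l N + (β l * v l) • (X N : MvPolynomial (Fin n) K) • c := by
    intro l
    rw [hF.mapDerived_smul, hF.mapDerived_genBracket, hv, zero_smul, smul_zero, sub_zero, smul_add]
    simp only [smul_smul]
    congr 2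
    ring
  calc mapDerived F (row N β) = ∑ l, mapDerived F (β l • genBracket K l N) := map_sum G _ _
    _ = row N β + (β ⬝ᵥ v) • (X N : MvPolynomial (Fin n) K) • c := by
      simp only [h, Finset.sum_add_distrib, row, dotProduct, Finset.sum_smul]
    _ = row N β := by rw [hβ, zero_smul, add_zero]

/-- The map `x ↦ x + v · row α` is given by an almost tame automorphism. -/
def IsTameTransvection (N : Fin n) (v α : Fin n → MvPolynomial (Fin n) K) : Prop :=
  ∃ e : FreeMetabelianLie K n ≃ₗ⁅K⁆ FreeMetabelianLie K n,
    IsShift e.toLieHom (fun l => v l • row N α) ∧ IsAlmostTame K n e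

theorem exists_equiv_of_inverse {u v : Fin n → FreeMetabelianLie K n}
    (huv : ∀ i, lift u (v i) = xg K n i) (hvu : ∀ i, lift v (u i) = xg K n i) :
    ∃ e : FreeMetabelianLie K n ≃ₗ⁅K⁆ FreeMetabelianLie K n, ∀ i, e (xg K n i) = u i := by
  have h₁ : (lift u).comp (lift v) = LieHom.id := hom_ext fun i => by simp [huv]
  have h₂ : (lift v).comp (lift u) = LieHom.id := hom_ext fun i => by simp [hvu]
  exact ⟨{ lift u with
    invFun := lift v
    left_inv := LieHom.congr_fun h₂
    right_inv := LieHom.congr_fun h₁ }, fun i => lift_xg u i⟩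

/-- The image `xᵢ + vᵢ · row α` of the `i`-th generator under a transvection. -/
def transvectionValue (N : Fin n) (v α : Fin n → MvPolynomial (Fin n) K) (i : Fin n) :
    FreeMetabelianLie K n :=
  xg K n i + ((v i • row N α : Derived K n) : FreeMetabelianLie K n)

theorem IsShift.map_transvectionValue
    {F : FreeMetabelianLie K n →ₗ⁅K⁆ FreeMetabelianLie K n} {N : Fin n}
    {v α β w : Fin n → MvPolynomial (Fin n) K} (hF : IsShift F fun l => v l • row N α)
    (hv : v N = 0) (hβ : β ⬝ᵥ v = 0) (i : Fin n) :
    F (transvectionValue N w β i) =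
      xg K n i + ((v i • row N α + w i • row N β : Derived K n) : FreeMetabelianLie K n) := by
  have h : mapDerived F (w i • row N β) = w i • row N β := by
    rw [hF.mapDerived_smul, hF.map_row hv hβ]
  rw [transvectionValue, map_add, hF i, add_assoc]
  exact congrArg (fun d : Derived K n =>
    xg K n i + (((v i • row N α : Derived K n) : FreeMetabelianLie K n) + d)) h

theorem exists_transvection {N : Fin n} {v α : Fin n → MvPolynomial (Fin n) K} (hv : v N = 0)
    (hα : α ⬝ᵥ v = 0) : ∃ e : FreeMetabelianLie K n ≃ₗ⁅K⁆ FreeMetabelianLie K n,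
      IsShift e.toLieHom (fun l => v l • row N α) := by
  have key : ∀ β : Fin n → MvPolynomial (Fin n) K, β ⬝ᵥ v = 0 → ∀ i,
      lift (transvectionValue N v β) (transvectionValue N v (-β) i) = xg K n i := by
    intro β hβ i
    have hF : IsShift (lift (transvectionValue N v β)) fun l => v l • row N β :=
      fun l => lift_xg _ l
    rw [hF.map_transvectionValue hv (by rw [neg_dotProduct, hβ, neg_zero]), row_neg, smul_neg,
      add_neg_cancel]
    exact add_zero _
  exact exists_equiv_of_inverse (key α hα) fun i => by
    have h := key (-α) (by rw [neg_dotProduct, hα, neg_zero]) i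
    rwa [neg_neg] at h

namespace IsTameTransvection

variable {N : Fin n} {v w α β : Fin n → MvPolynomial (Fin n) K}

theorem add_row (hv : v N = 0) (hβ : β ⬝ᵥ v = 0) (h₁ : IsTameTransvection N v α)
    (h₂ : IsTameTransvection N v β) : IsTameTransvection N v (α + β) := by
  obtain ⟨e₁, he₁, ht₁⟩ := h₁
  obtain ⟨e₂, he₂, ht₂⟩ := h₂
  refine ⟨e₁ * e₂, fun i => ?_, Subgroup.mul_mem _ ht₁ ht₂⟩
  beta_reduce
  rw [row_add, smul_add]
  exact (congrArg e₁ (he₂ i)).trans (he₁.map_transvectionValue hv hβ i)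

theorem add_column (hv : v N = 0) (hα : α ⬝ᵥ v = 0) (h₁ : IsTameTransvection N v α)
    (h₂ : IsTameTransvection N w α) : IsTameTransvection N (v + w) α := by
  obtain ⟨e₁, he₁, ht₁⟩ := h₁
  obtain ⟨e₂, he₂, ht₂⟩ := h₂
  refine ⟨e₁ * e₂, fun i => ?_, Subgroup.mul_mem _ ht₁ ht₂⟩
  beta_reduce
  rw [Pi.add_apply, add_smul]
  exact (congrArg e₁ (he₂ i)).trans (he₁.map_transvectionValue hv hα i)

theorem smul_column {s : MvPolynomial (Fin n) K} (h : IsTameTransvection N v (s • α)) :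
    IsTameTransvection N (s • v) α := by
  obtain ⟨e, he, ht⟩ := h
  refine ⟨e, fun i => ?_, ht⟩
  rw [he i]
  beta_reduce
  rw [row_smul, Pi.smul_apply, smul_eq_mul, mul_comm, mul_smul]

theorem single {i : Fin n} (hi : i ≠ N) (hα : α i = 0) (p : MvPolynomial (Fin n) K) :
    IsTameTransvection N (Pi.single i p) α := by
  obtain ⟨e, he⟩ := exists_transvection (N := N) (v := Pi.single i p) (α := α)
    (Pi.single_eq_of_ne hi.symm _) (by rw [dotProduct_single, hα, zero_mul])
  refine ⟨e, he, Subgroup.subset_closure ⟨i, fun j hj => (he j).trans ?_⟩⟩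
  beta_reduce
  rw [Pi.single_eq_of_ne hj, zero_smul]
  exact add_zero _

end IsTameTransvection

theorem isAlmostTame_of_fixes {L t : FreeMetabelianLie K n ≃ₗ⁅K⁆ FreeMetabelianLie K n}
    (hL : IsAlmostTame K n L) (j : Fin n)
    (h : ∀ l, l ≠ j → t (L (xg K n l)) = L (xg K n l)) : IsAlmostTame K n t := by
  have hc : IsAlmostTame K n (L⁻¹ * t * L) := by
    refine Subgroup.subset_closure ⟨j, fun l hl => ?_⟩
    change L.symm (t (L (xg K n l))) = xg K n l
    rw [h l hl, LieEquiv.symm_apply_apply]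
  have := Subgroup.mul_mem _ (Subgroup.mul_mem _ hL hc) (Subgroup.inv_mem _ hL)
  rwa [mul_assoc, mul_assoc, mul_assoc, mul_inv_cancel, mul_one, mul_inv_cancel_left] at this

theorem exists_sub_chein (i : Fin n) (w : FreeMetabelianLie K n)
    (hw : ∀ F : FreeMetabelianLie K n →ₗ⁅K⁆ FreeMetabelianLie K n,
      (∀ l, l ≠ i → F (xg K n l) = xg K n l) → F w = w) :
    ∃ L : FreeMetabelianLie K n ≃ₗ⁅K⁆ FreeMetabelianLie K n, IsAlmostTame K n L ∧
      L (xg K n i) = xg K n i - w ∧ ∀ l, l ≠ i → L (xg K n l) = xg K n l := by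
  have hfix : ∀ z : FreeMetabelianLie K n, ∀ l, l ≠ i →
      lift (Function.update (xg K n) i z) (xg K n l) = xg K n l := fun z l hl => by
    rw [lift_xg, Function.update_of_ne hl]
  have key : ∀ z z' : FreeMetabelianLie K n,
      lift (Function.update (xg K n) i z) z' = xg K n i → ∀ l,
      lift (Function.update (xg K n) i z) (Function.update (xg K n) i z' l) = xg K n l := by
    intro z z' hz l
    rcases eq_or_ne l i with rfl | hl
    · rwa [Function.update_self]
    · rw [Function.update_of_ne hl, hfix z l hl]
  obtain ⟨L, hL⟩ := exists_equiv_of_inverse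
    (u := Function.update (xg K n) i (xg K n i - w))
    (v := Function.update (xg K n) i (xg K n i + w))
    (key _ _ (by rw [map_add, hw _ (hfix _), lift_xg, Function.update_self, sub_add_cancel]))
    (key _ _ (by rw [map_sub, hw _ (hfix _), lift_xg, Function.update_self, add_sub_cancel_right]))
  have hL' : ∀ l, l ≠ i → L (xg K n l) = xg K n l := fun l hl => by
    rw [hL, Function.update_of_ne hl]
  exact ⟨L, Subgroup.subset_closure ⟨i, hL'⟩, by rw [hL, Function.update_self], hL'⟩

/-- For all `i ≠ j` different from `N` and all `h`, the transvection with column `r eᵢ + eⱼ` and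
row `h ([xᵢ, x_N] - r [xⱼ, x_N])` is almost tame. -/
def IsTameCoeff (N : Fin n) (r : MvPolynomial (Fin n) K) : Prop :=
  ∀ i j : Fin n, i ≠ j → i ≠ N → j ≠ N → ∀ h : MvPolynomial (Fin n) K,
    IsTameTransvection N (Pi.single i r + Pi.single j 1) (Pi.single i h - Pi.single j (h * r))

theorem isTameTransvection_of_conj {N i j : Fin n} (hij : i ≠ j) (hi : i ≠ N) (hj : j ≠ N)
    {r : MvPolynomial (Fin n) K} (w : FreeMetabelianLie K n)
    (hw : ∀ F : FreeMetabelianLie K n →ₗ⁅K⁆ FreeMetabelianLie K n,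
      (∀ l, l ≠ i → F (xg K n l) = xg K n l) → F w = w)
    (hr : ∀ (F : FreeMetabelianLie K n →ₗ⁅K⁆ FreeMetabelianLie K n) (m : Derived K n),
      (∀ l, l ≠ i → l ≠ j → F (xg K n l) = xg K n l) → F (xg K n j) = xg K n j + m →
        F w = w + (r • m : Derived K n)) (h : MvPolynomial (Fin n) K) :
    IsTameTransvection N (Pi.single i r + Pi.single j 1)
      (Pi.single i h - Pi.single j (h * r)) := by
  obtain ⟨t, ht⟩ := exists_transvection (N := N) (v := Pi.single i r + Pi.single j 1)
    (α := Pi.single i h - Pi.single j (h * r))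
    (by simp [hi.symm, hj.symm])
    (by simp [hij, hij.symm])
  obtain ⟨L, hL, hLi, hLl⟩ := exists_sub_chein i w hw
  have hfix : ∀ l, l ≠ i → l ≠ j → t (xg K n l) = xg K n l := fun l hli hlj => by
    refine (ht l).trans ?_
    simp [hli, hlj]
  have htj := ht j
  have hti := ht i
  simp only [Pi.add_apply, Pi.single_eq_same, Pi.single_eq_of_ne hij, Pi.single_eq_of_ne hij.symm,
    zero_add, add_zero, one_smul] at hti htj
  refine ⟨t, ht, isAlmostTame_of_fixes hL j fun l hl => ?_⟩
  rcases eq_or_ne l i with rfl | hli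
  · rw [hLi, map_sub]
    refine (congrArg₂ (· - ·) hti (hr t.toLieHom _ hfix htj)).trans ?_
    exact add_sub_add_right_eq_sub _ _ _
  · rw [hLl l hli, hfix l hli hl]

theorem isTameCoeff_C (N : Fin n) (c : K) : IsTameCoeff N (C c) := by
  intro i j hij hi hj
  refine isTameTransvection_of_conj hij hi hj (c • xg K n j) (fun F hF => ?_) fun F m _ hm => ?_
  · rw [map_smul, hF j hij.symm]
  · rw [map_smul, hm, smul_add, C_smul]
    rfl

theorem isTameTransvection_X {N i j k : Fin n} (hij : i ≠ j) (hi : i ≠ N) (hj : j ≠ N)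
    (hki : k ≠ i) (hkj : k ≠ j) (h : MvPolynomial (Fin n) K) :
    IsTameTransvection N (Pi.single i (X k) + Pi.single j 1)
      (Pi.single i h - Pi.single j (h * X k)) := by
  refine isTameTransvection_of_conj hij hi hj ⁅xg K n j, xg K n k⁆ (fun F hF => ?_)
    (fun F m hF hm => ?_) h
  · rw [LieHom.map_lie, hF j hij.symm, hF k hki]
  · rw [LieHom.map_lie, hm, hF k hki hkj, add_lie, coe_X_smul]

theorem isTameTransvection_mul {N i j k : Fin n} (hij : i ≠ j) (hik : i ≠ k) (hjk : j ≠ k)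
    (hi : i ≠ N) (hj : j ≠ N) (hk : k ≠ N) {r s : MvPolynomial (Fin n) K}
    (hr : ∀ h : MvPolynomial (Fin n) K, IsTameTransvection N (Pi.single i r + Pi.single k 1)
      (Pi.single i h - Pi.single k (h * r)))
    (hs : ∀ h : MvPolynomial (Fin n) K, IsTameTransvection N (Pi.single k s + Pi.single j 1)
      (Pi.single k h - Pi.single j (h * s))) (h : MvPolynomial (Fin n) K) :
    IsTameTransvection N (Pi.single i (r * s) + Pi.single j 1)
      (Pi.single i h - Pi.single j (h * (r * s))) := by
  have e₁ : IsTameTransvection N (Pi.single j 1 + s • (Pi.single i r + Pi.single k 1))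
      (Pi.single i h - Pi.single k (h * r)) := by
    refine .add_column (by simp [hj.symm]) (by simp [hij, hjk])
      (.single hj (by simp [hij.symm, hjk]) _) (.smul_column ?_)
    convert hr (s * h) using 1
    simp [smul_sub, ← Pi.single_smul, mul_assoc]
  have e₂ : IsTameTransvection N (Pi.single i (r * s) + (Pi.single k s + Pi.single j 1))
      (Pi.single k (h * r) - Pi.single j (h * r * s)) :=
    .add_column (by simp [hi.symm]) (by simp [hij, hik])
      (.single hi (by simp [hij, hik]) _) (hs (h * r))
  have e₃ : IsTameTransvection N (Pi.single j 1 + s • (Pi.single i r + Pi.single k 1))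
      ((Pi.single i h - Pi.single k (h * r)) + (Pi.single k (h * r) - Pi.single j (h * r * s))) := by
    refine .add_row ?_ ?_ e₁ ?_
    · simp [hi.symm, hj.symm, hk.symm]
    · simp [hij, hik, hjk, hjk.symm]
      ring
    · convert e₂ using 1
      simp only [smul_add, ← Pi.single_smul, smul_eq_mul, mul_one, mul_comm r s]
      abel
  have e₄ := IsTameTransvection.add_column (v := Pi.single k (-s)) ?_ ?_ (.single hk ?_ _) e₃
  · convert e₄ using 1
    · simp only [smul_add, ← Pi.single_smul, smul_eq_mul, mul_one, mul_comm r s, Pi.single_neg]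
      abel
    · rw [mul_assoc]
      abel
  · simp [hk.symm]
  · simp [hik.symm, hjk.symm]
  · simp [hik.symm, hjk.symm]

theorem isTameTransvection_add {N i j k : Fin n} (hij : i ≠ j) (hik : i ≠ k) (hjk : j ≠ k)
    (hi : i ≠ N) (hj : j ≠ N) (hk : k ≠ N) {r s : MvPolynomial (Fin n) K}
    (hr : IsTameCoeff N r) (hs : IsTameCoeff N s) (h : MvPolynomial (Fin n) K) :
    IsTameTransvection N (Pi.single i (r + s) + Pi.single j 1)
      (Pi.single i h - Pi.single j (h * (r + s))) := by
  have e₁ : IsTameTransvection N (Pi.single i r + Pi.single j 1)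
      ((Pi.single i h - Pi.single j (h * r)) + Pi.single k (-(h * s))) := by
    refine .add_row (by simp [hi.symm, hj.symm]) (by simp [hik.symm, hjk.symm])
      (hr i j hij hi hj h) (.add_column (by simp [hi.symm]) (by simp [hik]) ?_ ?_)
    · exact .single hi (by simp [hik]) _
    · exact .single hj (by simp [hjk]) _
  have e₂ : IsTameTransvection N (Pi.single i s + Pi.single k 1)
      ((Pi.single i h - Pi.single k (h * s)) + Pi.single j (-(h * r))) := by
    refine .add_row (by simp [hi.symm, hk.symm]) (by simp [hij.symm, hjk])
      (hs i k hik hi hk h) (.add_column (by simp [hi.symm]) (by simp [hij]) ?_ ?_)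
    · exact .single hi (by simp [hij]) _
    · exact .single hk (by simp [hjk.symm]) _
  have e₃ : IsTameTransvection N
      ((Pi.single i r + Pi.single j 1) + (Pi.single i s + Pi.single k 1))
      ((Pi.single i h - Pi.single j (h * r)) + Pi.single k (-(h * s))) := by
    refine .add_column (by simp [hi.symm, hj.symm]) ?_ e₁ ?_
    · simp [hij, hik, hjk, hij.symm]
    · convert e₂ using 1
      simp only [Pi.single_neg]
      abel
  have e₄ : IsTameTransvection N (Pi.single i (r + s) + (Pi.single j 1 + Pi.single k 1))
      (Pi.single j (-(h * s)) - Pi.single k (-(h * s) * 1)) :=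
    .add_column (by simp [hi.symm]) (by simp [hij, hik]) (.single hi (by simp [hij, hik]) _)
      (by simpa only [C_1] using isTameCoeff_C N (1 : K) j k hjk hj hk (-(h * s)))
  have e₅ : IsTameTransvection N
      ((Pi.single i r + Pi.single j 1) + (Pi.single i s + Pi.single k 1))
      (((Pi.single i h - Pi.single j (h * r)) + Pi.single k (-(h * s))) +
        (Pi.single j (-(h * s)) - Pi.single k (-(h * s) * 1))) := by
    refine .add_row (by simp [hi.symm, hj.symm, hk.symm]) ?_ e₃ ?_
    · simp [hij, hik, hjk, hjk.symm]
    · convert e₄ using 1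
      rw [Pi.single_add]
      abel
  have e₆ := IsTameTransvection.add_column (v := Pi.single k (-1)) ?_ ?_ (.single hk ?_ _) e₅
  · convert e₆ using 1
    · simp only [Pi.single_add, Pi.single_neg]
      abel
    · simp only [mul_add, mul_one, Pi.single_add, Pi.single_neg]
      abel
  · simp [hk.symm]
  · simp [hik.symm, hjk.symm]
  · simp [hik.symm, hjk.symm]

theorem exists_fin_ne (hn : 4 ≤ n) (a b c : Fin n) : ∃ k, k ≠ a ∧ k ≠ b ∧ k ≠ c := by
  have h : ({a, b, c} : Finset (Fin n)).card < (Finset.univ : Finset (Fin n)).card := by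
    rw [Finset.card_univ, Fintype.card_fin]
    exact Finset.card_le_three.trans_lt hn
  obtain ⟨k, -, hk⟩ := Finset.exists_mem_notMem_of_card_lt_card h
  exact ⟨k, by simpa using hk⟩

theorem isTameCoeff_X (hn : 4 ≤ n) (N l : Fin n) :
    IsTameCoeff N (X l : MvPolynomial (Fin n) K) := by
  intro i j hij hi hj h
  obtain ⟨k, hki, hkj, hk⟩ := exists_fin_ne hn i j N
  have one : IsTameCoeff N (1 : MvPolynomial (Fin n) K) := by
    simpa only [C_1] using isTameCoeff_C N (1 : K)
  rcases eq_or_ne l i with rfl | hli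
  · simpa only [one_mul] using isTameTransvection_mul hij hki.symm hkj.symm hi hj hk
      (one l k hki.symm hi hk) (isTameTransvection_X hkj hk hj hki.symm hij) h
  rcases eq_or_ne l j with rfl | hlj
  · simpa only [mul_one] using isTameTransvection_mul hij hki.symm hkj.symm hi hj hk
      (isTameTransvection_X hki.symm hi hk hij.symm hkj.symm) (one k l hkj hk hj) h
  · exact isTameTransvection_X hij hi hj hli hlj h

theorem isTameCoeff (hn : 4 ≤ n) (N : Fin n) (r : MvPolynomial (Fin n) K) : IsTameCoeff N r := by
  induction r using MvPolynomial.induction_on with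
  | C c => exact isTameCoeff_C N c
  | add p q hp hq =>
    intro i j hij hi hj h
    obtain ⟨k, hki, hkj, hk⟩ := exists_fin_ne hn i j N
    exact isTameTransvection_add hij hki.symm hkj.symm hi hj hk hp hq h
  | mul_X p l hp =>
    intro i j hij hi hj h
    obtain ⟨k, hki, hkj, hk⟩ := exists_fin_ne hn i j N
    exact isTameTransvection_mul hij hki.symm hkj.symm hi hj hk (hp i k hki.symm hi hk)
      (isTameCoeff_X hn N l k j hkj hk hj) h

theorem isTameTransvection_pair (hn : 4 ≤ n) {N i j : Fin n} (hij : i ≠ j) (hi : i ≠ N)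
    (hj : j ≠ N) (h f g : MvPolynomial (Fin n) K) :
    IsTameTransvection N (Pi.single i g + Pi.single j (-f))
      (Pi.single i (h * f) + Pi.single j (h * g)) := by
  obtain ⟨k, hki, hkj, hk⟩ := exists_fin_ne hn i j N
  have e₁ : IsTameTransvection N (Pi.single j (-f) + (Pi.single i g + Pi.single k 1))
      (Pi.single i (h * f) - Pi.single k (h * f * g)) :=
    .add_column (by simp [hj.symm]) (by simp [hij, hkj])
      (.single hj (by simp [hij.symm, hkj.symm]) _) (isTameCoeff hn N g i k hki.symm hi hk _)
  have e₂ : IsTameTransvection N (Pi.single i g + (Pi.single j (-f) + Pi.single k 1))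
      (Pi.single j (h * g) - Pi.single k (h * g * -f)) :=
    .add_column (by simp [hi.symm]) (by simp [hij.symm, hki])
      (.single hi (by simp [hij, hki.symm]) _) (isTameCoeff hn N (-f) j k hkj.symm hj hk _)
  have e₃ : IsTameTransvection N (Pi.single j (-f) + (Pi.single i g + Pi.single k 1))
      ((Pi.single i (h * f) - Pi.single k (h * f * g)) +
        (Pi.single j (h * g) - Pi.single k (h * g * -f))) := by
    refine .add_row (by simp [hi.symm, hj.symm, hk.symm]) ?_ e₁ ?_
    · simp [hij.symm, hkj, hki.symm, hkj.symm]
    · convert e₂ using 1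
      abel
  have e₄ := IsTameTransvection.add_column (v := Pi.single k (-1)) ?_ ?_ (.single hk ?_ _) e₃
  · convert e₄ using 1
    · simp only [Pi.single_neg]
      abel
    · rw [mul_neg, mul_right_comm h g f]
      simp only [Pi.single_neg]
      abel
  · simp [hk.symm]
  · simp [hki, hkj]
    ring
  · simp [hki, hkj]
    ring

end FreeMetabelianLie

end

/-- **Theorem 3.** Over any field `K`, for `n ≥ 4` and all `h, f, g ∈ U = K[y₁,…,yₙ]`, the
endomorphism
`B(h,f,g) = (x₁ + [x₁,xₙ]hfg + [x₂,xₙ]hg², x₂ - [x₁,xₙ]hf² - [x₂,xₙ]hfg, x₃, …, xₙ)`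
of `Mₙ` is an automorphism and is almost tame. -/
theorem B_h_f_g_is_almost_tame (K : Type) [Field K] (n : ℕ) (hn : 4 ≤ n)
    (h f g : MvPolynomial (Fin n) K)
    (i0 i1 iN : Fin n) (h0 : (i0 : ℕ) = 0) (h1 : (i1 : ℕ) = 1) (hN : (iN : ℕ) = n - 1)
    (φ : FreeMetabelianLie K n →ₗ⁅K⁆ FreeMetabelianLie K n)
    (hφ0 : φ (xg K n i0) = xg K n i0 + polyAct K n (h * f * g) ⁅xg K n i0, xg K n iN⁆
      + polyAct K n (h * g ^ 2) ⁅xg K n i1, xg K n iN⁆)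
    (hφ1 : φ (xg K n i1) = xg K n i1 - polyAct K n (h * f ^ 2) ⁅xg K n i0, xg K n iN⁆
      - polyAct K n (h * f * g) ⁅xg K n i1, xg K n iN⁆)
    (hφ : ∀ j : Fin n, j ≠ i0 → j ≠ i1 → φ (xg K n j) = xg K n j) :
    Function.Bijective φ ∧
      ∃ e : FreeMetabelianLie K n ≃ₗ⁅K⁆ FreeMetabelianLie K n,
        (∀ m, e m = φ m) ∧ IsAlmostTame K n e := by
  have hij : i0 ≠ i1 := fun h => by simp [← h, h0] at h1
  have hi : i0 ≠ iN := fun h => by rw [← h] at hN; omega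
  have hj : i1 ≠ iN := fun h => by rw [← h] at hN; omega
  obtain ⟨e, he, ht⟩ := FreeMetabelianLie.isTameTransvection_pair hn hij hi hj h f g
  have hpoly : ∀ (a : MvPolynomial (Fin n) K) (i : Fin n),
      polyAct K n a ⁅xg K n i, xg K n iN⁆ =
        (a • FreeMetabelianLie.genBracket K i iN : FreeMetabelianLie.Derived K n) :=
    fun a i => FreeMetabelianLie.polyAct_coe a (FreeMetabelianLie.genBracket K i iN)
  have heφ : e.toLieHom = φ := by
    refine FreeMetabelianLie.hom_ext fun l => (he l).trans ?_
    beta_reduce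
    rw [FreeMetabelianLie.row_add, FreeMetabelianLie.row_single, FreeMetabelianLie.row_single]
    rcases eq_or_ne l i0 with rfl | hl0
    · rw [hφ0, hpoly, hpoly, Pi.add_apply, Pi.single_eq_same, Pi.single_eq_of_ne hij, add_zero,
        smul_add, smul_smul, smul_smul, mul_comm g, mul_comm g, mul_assoc h g g, ← sq, add_assoc]
      rfl
    rcases eq_or_ne l i1 with rfl | hl1
    · rw [hφ1, hpoly, hpoly, Pi.add_apply, Pi.single_eq_same, Pi.single_eq_of_ne hl0, zero_add,
        smul_add, smul_smul, smul_smul, neg_mul, neg_mul, neg_smul, neg_smul, mul_comm f,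
        mul_comm f, mul_assoc h f f, ← sq, mul_right_comm h g f, sub_sub, ← neg_add,
        sub_eq_add_neg]
      rfl
    · rw [hφ l hl0 hl1, Pi.add_apply, Pi.single_eq_of_ne hl0, Pi.single_eq_of_ne hl1, add_zero,
        zero_smul]
      exact add_zero _
  have heφ' : ∀ m, e m = φ m := fun m => LieHom.congr_fun heφ m
  refine ⟨?_, e, heφ', ht⟩
  rw [← funext heφ']
  exact e.bijective
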